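/- Let 𝒳 be a finite subset of ℤ^r and let d be a fixed positive integer. There exists a positive integer n_0, depending only on 𝒳 and d, such that for every positive integer n and every n × d zero-sum matrix A with entries in 𝒳, there exists a partition {I_1,…,I_L} of the row set {1,…,n} into nonempty blocks, each of size at most n_0, such that for every block I_ℓ the submatrix of A on the rows in I_ℓ is zero-sum, i.e. Σ_{i∈I_ℓ} Σ_{j=1}^d A(i,j) = 0. -/

import Mathlib

/-- Over a finite set `T` of values, every nonempty zero-sum family contains a nonempty zero-sum
subfamily of size bounded in terms of `T` alone. -/
theorem exists_bound_zero_sum_subfamily {M : Type*} [AddCommGroup M] [DecidableEq M]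
    (T : Finset M) :
    ∃ N : ℕ, ∀ (ι : Type) [DecidableEq ι] (f : ι → M) (s : Finset ι), s.Nonempty →
      (∀ i ∈ s, f i ∈ T) → ∑ i ∈ s, f i = 0 →
      ∃ t ⊆ s, t.Nonempty ∧ t.card ≤ N ∧ ∑ i ∈ t, f i = 0 := by
  let P : (T → ℕ) → Prop := fun m => m ≠ 0 ∧ ∑ v, m v • (v : M) = 0
  have hfin : {m | Minimal P m}.Finite :=
    WellQuasiOrderedLE.finite_of_isAntichain (setOfPred_minimal_antichain P)
  obtain ⟨N, hN⟩ := (hfin.image fun m => ∑ v, m v).bddAbove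
  refine ⟨N, fun ι _ f s hs hT h0 => ?_⟩
  let fiber : T → Finset ι := fun v => {i ∈ s | f i = v}
  have hc : P fun v => (fiber v).card := by
    constructor
    · obtain ⟨i, hi⟩ := hs
      intro h
      have h1 := congrFun h ⟨f i, hT i hi⟩
      have h2 : i ∈ fiber ⟨f i, hT i hi⟩ := by simp [fiber, hi]
      exact (Finset.card_pos.2 ⟨i, h2⟩).ne' h1
    · rw [← h0, ← Finset.sum_fiberwise_of_maps_to hT, ← Finset.sum_coe_sort T]
      refine Finset.sum_congr rfl fun v _ => ?_
      rw [Finset.sum_congr rfl fun i hi => (Finset.mem_filter.1 hi).2, Finset.sum_const]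
  obtain ⟨m, hmc, hm⟩ := exists_minimal_le_of_wellFoundedLT P _ hc
  choose g hg hgm using fun v => Finset.exists_subset_card_eq (hmc v)
  have hgv : ∀ v, ∀ i ∈ g v, f i = v := fun v i hi => (Finset.mem_filter.1 (hg v hi)).2
  have hdisj : Set.PairwiseDisjoint (Finset.univ : Finset T) g := fun v _ w _ hvw =>
    Finset.disjoint_left.2 fun i hi hi' => hvw (Subtype.ext ((hgv v i hi).symm.trans (hgv w i hi')))
  refine ⟨Finset.univ.biUnion g, ?_, ?_, ?_, ?_⟩
  · exact Finset.biUnion_subset.2 fun v _ => (hg v).trans (Finset.filter_subset _ _)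
  · obtain ⟨v, hv⟩ := Function.ne_iff.1 hm.prop.1
    obtain ⟨i, hi⟩ := Finset.card_pos.1 ((hgm v).symm ▸ Nat.pos_of_ne_zero hv)
    exact ⟨i, Finset.mem_biUnion.2 ⟨v, Finset.mem_univ v, hi⟩⟩
  · rw [Finset.card_biUnion hdisj, Finset.sum_congr rfl fun v _ => hgm v]
    exact hN ⟨m, hm, rfl⟩
  · rw [Finset.sum_biUnion hdisj, ← hm.prop.2]
    refine Finset.sum_congr rfl fun v _ => ?_
    rw [Finset.sum_congr rfl (hgv v), Finset.sum_const, hgm]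

/-- If every nonempty zero-sum subfamily contains a nonempty zero-sum subfamily of size at most
`N`, then every zero-sum subfamily can be partitioned into zero-sum blocks of size at most `N`. -/
theorem exists_finpartition_zero_sum {ι M : Type*} [DecidableEq ι] [AddCommGroup M] {f : ι → M}
    {N : ℕ} (h : ∀ s : Finset ι, s.Nonempty → ∑ i ∈ s, f i = 0 →
      ∃ t ⊆ s, t.Nonempty ∧ t.card ≤ N ∧ ∑ i ∈ t, f i = 0)
    (s : Finset ι) (hs : ∑ i ∈ s, f i = 0) :
    ∃ P : Finpartition s, ∀ t ∈ P.parts, t.card ≤ N ∧ ∑ i ∈ t, f i = 0 := by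
  induction s using Finset.strongInduction with
  | H s ih =>
    rcases s.eq_empty_or_nonempty with rfl | hne
    · exact ⟨Finpartition.empty _, fun t ht => absurd ht (Finset.notMem_empty t)⟩
    · obtain ⟨t, hts, ht, htN, ht0⟩ := h s hne hs
      obtain ⟨P, hP⟩ := ih (s \ t) (Finset.sdiff_ssubset hts ht) (by
        rw [Finset.sum_sdiff_eq_sub hts, hs, ht0, sub_zero])
      refine ⟨P.extend ht.ne_empty Finset.sdiff_disjoint (Finset.sdiff_union_of_subset hts), ?_⟩
      intro u hu
      rcases Finset.mem_insert.1 hu with rfl | hu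
      · exact ⟨htN, ht0⟩
      · exact hP u hu


/-- For a finite set `𝒳 ⊆ ℤ^r` and a fixed positive integer `d` there
is a positive integer `n₀` such that for every `n × d` zero-sum matrix `A` with entries
in `𝒳`, the rows `{1,…,n}` can be partitioned into nonempty blocks, each of size at
most `n₀`, such that the submatrix on each block of rows is zero-sum. -/
theorem zero_sum_row_partition (r : ℕ) (𝒳 : Finset (Fin r → ℤ)) (d : ℕ) (hd : 0 < d) :
    ∃ n₀ : ℕ, 0 < n₀ ∧
      ∀ n : ℕ, 0 < n →
        ∀ A : Fin n → Fin d → (Fin r → ℤ),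
          (∀ i j, A i j ∈ 𝒳) →
          (∑ i, ∑ j, A i j = 0) →
          ∃ (L : ℕ) (I : Fin L → Finset (Fin n)),
            (∀ ℓ, (I ℓ).Nonempty ∧ (I ℓ).card ≤ n₀ ∧ ∑ i ∈ I ℓ, ∑ j, A i j = 0) ∧
            (∀ i : Fin n, ∃! ℓ, i ∈ I ℓ) := by
  classical
  obtain ⟨N, hN⟩ := exists_bound_zero_sum_subfamily
    ((Fintype.piFinset fun _ : Fin d => 𝒳).image fun a => ∑ j, a j)
  refine ⟨N + 1, N.succ_pos, fun n _ A hA h0 => ?_⟩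
  obtain ⟨P, hP⟩ := exists_finpartition_zero_sum (f := fun i => ∑ j, A i j)
    (fun s hs => hN (Fin n) (fun i => ∑ j, A i j) s hs fun i _ =>
      Finset.mem_image.2 ⟨A i, Fintype.mem_piFinset.2 (hA i), rfl⟩) Finset.univ h0
  let e := P.parts.equivFin.symm
  refine ⟨P.parts.card, fun ℓ => e ℓ, fun ℓ => ?_, fun i => ?_⟩
  · have hℓ := hP _ (e ℓ).2
    exact ⟨P.nonempty_of_mem_parts (e ℓ).2, hℓ.1.trans N.le_succ, hℓ.2⟩
  · obtain ⟨t, ⟨ht, hit⟩, huniq⟩ := P.existsUnique_mem (Finset.mem_univ i)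
    refine ⟨e.symm ⟨t, ht⟩, by simpa using hit, fun ℓ hℓ => ?_⟩
    rw [Equiv.eq_symm_apply]
    exact Subtype.ext (huniq _ ⟨(e ℓ).2, hℓ⟩)
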